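/- Spline stability estimate (de Boor): for each nonnegative integer d and each n ∈ ℕ there exist constants c₁, c₂ > 0 (independent of n) such that for every (ξ_k) ∈ ℓ²(ℤ): ‖(ξ_k)‖_{ℓ²} ≤ c₁ √n ‖Σ_k ξ_k φ̂^{(d)}(n·−k)‖_{L²(ℝ)} ≤ c₂ ‖(ξ_k)‖_{ℓ²}. -/

import Mathlib

open MeasureTheory

noncomputable def chi : ℝ → ℝ := Set.indicator (Set.Ico 0 1) 1

noncomputable def bspline : ℕ → ℝ → ℝ
  | 0 => chi
  | d + 1 => fun s => ∫ x : ℝ, chi (s - x) * bspline d x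

theorem measurable_chi : Measurable chi :=
  measurable_one.indicator measurableSet_Ico

theorem chi_nonneg (s : ℝ) : 0 ≤ chi s :=
  Set.indicator_nonneg (fun _ _ => zero_le_one) s

theorem chi_le_one (s : ℝ) : chi s ≤ 1 :=
  Set.indicator_le_self' (fun _ _ => zero_le_one) s

theorem chi_sub_eq_indicator (s : ℝ) :
    (fun x => chi (s - x)) = Set.indicator (Set.Ioc (s - 1) s) 1 := by
  funext x
  simp only [chi, Set.indicator, Set.mem_Ico, Set.mem_Ioc, Pi.one_apply]
  congr 1
  apply propext
  constructor <;> rintro ⟨h₁, h₂⟩ <;> constructor <;> linarith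

theorem integrable_chi_sub (s : ℝ) : Integrable fun x => chi (s - x) := by
  rw [chi_sub_eq_indicator, integrable_indicator_iff measurableSet_Ioc]
  exact integrableOn_const (by simp)

theorem integral_chi_sub (s : ℝ) : ∫ x, chi (s - x) = 1 := by
  rw [chi_sub_eq_indicator, integral_indicator_one measurableSet_Ioc]
  simp

theorem measurable_bspline (d : ℕ) : Measurable (bspline d) := by
  induction d with
  | zero => exact measurable_chi
  | succ d ih =>
    have h : StronglyMeasurable fun p : ℝ × ℝ => chi (p.1 - p.2) * bspline d p.2 :=
      ((measurable_chi.comp (measurable_fst.sub measurable_snd)).mul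
        (ih.comp measurable_snd)).stronglyMeasurable
    exact h.integral_prod_right'.measurable

theorem bspline_nonneg (d : ℕ) (s : ℝ) : 0 ≤ bspline d s := by
  induction d generalizing s with
  | zero => exact chi_nonneg s
  | succ d ih => exact integral_nonneg fun x => mul_nonneg (chi_nonneg _) (ih x)

theorem bspline_le_one (d : ℕ) (s : ℝ) : bspline d s ≤ 1 := by
  induction d generalizing s with
  | zero => exact chi_le_one s
  | succ d ih =>
    rw [← integral_chi_sub s]
    exact integral_mono_of_nonneg
      (.of_forall fun x => mul_nonneg (chi_nonneg _) (bspline_nonneg d x))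
      (integrable_chi_sub s)
      (.of_forall fun x => mul_le_of_le_one_right (chi_nonneg _) (ih x))

theorem norm_bspline_le_one (d : ℕ) (s : ℝ) : ‖bspline d s‖ ≤ 1 := by
  rw [Real.norm_of_nonneg (bspline_nonneg d s)]
  exact bspline_le_one d s

theorem bspline_eq_zero_of_notMem (d : ℕ) {s : ℝ} (hs : s ∉ Set.Ico (0 : ℝ) (d + 1)) :
    bspline d s = 0 := by
  induction d generalizing s with
  | zero => exact Set.indicator_of_notMem (by simpa using hs) _
  | succ d ih =>
    refine integral_eq_zero_of_ae (.of_forall fun x => ?_)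
    by_cases hx : x ∈ Set.Ico (0 : ℝ) (d + 1)
    · have : chi (s - x) = 0 := by
        refine Set.indicator_of_notMem (fun h => hs ?_) _
        push_cast
        exact ⟨by linarith [h.1, hx.1], by linarith [h.2, hx.2]⟩
      simp [this]
    · simp [ih hx]

/-- Convolution with `chi` is moved onto the test function, where it becomes integration over
`[x, x + 1]`. -/
theorem integral_mul_bspline_succ {G : ℝ → ℝ} (hG : Continuous G) (d : ℕ) :
    ∫ s, G s * bspline (d + 1) s = ∫ x, (∫ s in x..x + 1, G s) * bspline d x := by
  have hint : Integrable
      (Function.uncurry fun s x => G s * (chi (s - x) * bspline d x))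
      ((volume : Measure ℝ).prod volume) := by
    have hK : IsCompact (Set.Icc (0 : ℝ) (d + 2) ×ˢ Set.Icc (0 : ℝ) (d + 1)) :=
      isCompact_Icc.prod isCompact_Icc
    rw [← integrableOn_iff_integrable_of_support_subset ?_]
    · refine Integrable.mul_bdd (c := 1)
        (f := fun p : ℝ × ℝ => G p.1) (g := fun p => chi (p.1 - p.2) * bspline d p.2)
        ((hG.comp continuous_fst).continuousOn.integrableOn_compact hK) ?_ ?_
      · exact ((measurable_chi.comp (measurable_fst.sub measurable_snd)).mul
          ((measurable_bspline d).comp measurable_snd)).aestronglyMeasurable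
      · refine .of_forall fun p => ?_
        rw [Real.norm_of_nonneg (mul_nonneg (chi_nonneg _) (bspline_nonneg d _))]
        exact mul_le_one₀ (chi_le_one _) (bspline_nonneg d _) (bspline_le_one d _)
    · rintro ⟨s, x⟩ hp
      have hp' : G s * (chi (s - x) * bspline d x) ≠ 0 := hp
      have hx : x ∈ Set.Ico (0 : ℝ) (d + 1) := by
        by_contra h
        simp [bspline_eq_zero_of_notMem d h] at hp'
      have hs : s - x ∈ Set.Ico (0 : ℝ) 1 := by
        by_contra h
        simp [chi, Set.indicator_of_notMem h] at hp'
      exact ⟨⟨by linarith [hs.1, hx.1], by linarith [hs.2, hx.2]⟩, ⟨hx.1, hx.2.le⟩⟩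
  calc ∫ s, G s * bspline (d + 1) s
      = ∫ s, ∫ x, G s * (chi (s - x) * bspline d x) := by
        simp only [bspline, integral_const_mul]
    _ = ∫ x, ∫ s, G s * (chi (s - x) * bspline d x) := integral_integral_swap hint
    _ = ∫ x, (∫ s in x..x + 1, G s) * bspline d x := by
        congr 1
        funext x
        simp only [← mul_assoc, integral_mul_const]
        congr 1
        rw [intervalIntegral.integral_of_le (by linarith), ← integral_Ico_eq_integral_Ioc,
          ← integral_indicator measurableSet_Ico]
        congr 1
        funext s
        by_cases h : s ∈ Set.Ico x (x + 1)
        · have : s - x ∈ Set.Ico (0 : ℝ) 1 := ⟨by linarith [h.1], by linarith [h.2]⟩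
          simp [chi, this, h]
        · have : s - x ∉ Set.Ico (0 : ℝ) 1 :=
            fun h' => h ⟨by linarith [h'.1], by linarith [h'.2]⟩
          simp only [chi, Set.indicator_of_notMem this, Set.indicator_of_notMem h, mul_zero]

theorem intervalIntegral_iteratedDeriv_succ {F : ℝ → ℝ} (hF : ContDiff ℝ (⊤ : ℕ∞) F) (n : ℕ)
    (a b : ℝ) : ∫ s in a..b, iteratedDeriv (n + 1) F s =
      iteratedDeriv n F b - iteratedDeriv n F a := by
  have hc := hF.continuous_iteratedDeriv (n + 1) (by exact_mod_cast le_top)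
  have hd := hF.differentiable_iteratedDeriv n (by exact_mod_cast WithTop.coe_lt_top _)
  rw [iteratedDeriv_succ] at hc ⊢
  exact intervalIntegral.integral_deriv_eq_sub (fun x _ => hd x) (hc.intervalIntegrable _ _)

/-- The B-spline of order `d` is the Peano kernel of the forward difference of order `d + 1`. -/
theorem integral_iteratedDeriv_mul_bspline (d : ℕ) {F : ℝ → ℝ} (hF : ContDiff ℝ (⊤ : ℕ∞) F) :
    ∫ s, iteratedDeriv (d + 1) F s * bspline d s = (fwdDiff (1 : ℝ))^[d + 1] F 0 := by
  induction d generalizing F with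
  | zero =>
    have h : ∀ s, iteratedDeriv (0 + 1) F s * bspline 0 s =
        (Set.Ico (0 : ℝ) 1).indicator (iteratedDeriv (0 + 1) F) s := by
      intro s
      by_cases hs : s ∈ Set.Ico (0 : ℝ) 1 <;> simp [bspline, chi, hs]
    simp only [h]
    rw [integral_indicator measurableSet_Ico, integral_Ico_eq_integral_Ioc,
      ← intervalIntegral.integral_of_le zero_le_one, intervalIntegral_iteratedDeriv_succ hF]
    simp [fwdDiff]
  | succ d ih =>
    have hshift : ContDiff ℝ (⊤ : ℕ∞) fun x => F (x + 1) :=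
      hF.comp (contDiff_id.add contDiff_const)
    rw [integral_mul_bspline_succ
        (hF.continuous_iteratedDeriv (d + 1 + 1) (by exact_mod_cast le_top)),
      Function.iterate_succ_apply, ← ih (F := fwdDiff 1 F) (hshift.sub hF)]
    congr 1
    funext x
    rw [intervalIntegral_iteratedDeriv_succ hF]
    have hle : (((d + 1 : ℕ) : ℕ∞) : WithTop ℕ∞) ≤ ((⊤ : ℕ∞) : WithTop ℕ∞) := by
      exact_mod_cast le_top
    have : iteratedDeriv (d + 1) (fwdDiff 1 F) x =
        iteratedDeriv (d + 1) (fun x => F (x + 1)) x - iteratedDeriv (d + 1) F x :=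
      iteratedDeriv_fun_sub (hshift.of_le hle).contDiffAt (hF.of_le hle).contDiffAt
    rw [this, iteratedDeriv_comp_add_const]

open Polynomial in
/-- The polynomial `x (x + 1) ⋯ (x + d - 1) / d!`. -/
noncomputable def risingBinomial (d : ℕ) : ℝ[X] :=
  C ((d.factorial : ℝ)⁻¹) * ascPochhammer ℝ d

theorem risingBinomial_eval_zero (d : ℕ) : (risingBinomial (d + 1)).eval 0 = 0 := by
  simp [risingBinomial]

theorem risingBinomial_eval_add_one_sub (d : ℕ) (x : ℝ) :
    (risingBinomial (d + 1)).eval (x + 1) - (risingBinomial (d + 1)).eval x =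
      (risingBinomial d).eval (x + 1) := by
  have h : (ascPochhammer ℝ (d + 1)).eval x = x * (ascPochhammer ℝ d).eval (x + 1) := by
    rw [ascPochhammer_succ_left]
    simp [Polynomial.eval_comp]
  have hd : (d.factorial : ℝ) ≠ 0 := by exact_mod_cast d.factorial_ne_zero
  have hd' : (d : ℝ) + 1 ≠ 0 := by positivity
  simp only [risingBinomial, Polynomial.eval_mul, Polynomial.eval_C, h, ascPochhammer_succ_eval,
    Nat.factorial_succ]
  push_cast
  field_simp
  ring

/-- A smooth truncation of `risingBinomial d` to the positive half line. -/
noncomputable def smoothRisingBinomial (d : ℕ) (x : ℝ) : ℝ :=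
  Real.smoothTransition x * (risingBinomial d).eval x

theorem contDiff_smoothRisingBinomial (d : ℕ) :
    ContDiff ℝ (⊤ : ℕ∞) (smoothRisingBinomial d) :=
  Real.smoothTransition.contDiff.mul (by simpa using (risingBinomial d).contDiff_aeval (𝕜 := ℝ) _)

theorem smoothRisingBinomial_of_nonpos (d : ℕ) {x : ℝ} (hx : x ≤ 0) :
    smoothRisingBinomial d x = 0 := by
  simp [smoothRisingBinomial, Real.smoothTransition.zero_of_nonpos hx]

theorem smoothRisingBinomial_of_one_le (d : ℕ) {x : ℝ} (hx : 1 ≤ x) :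
    smoothRisingBinomial d x = (risingBinomial d).eval x := by
  simp [smoothRisingBinomial, Real.smoothTransition.one_of_one_le hx]

theorem fwdDiff_smoothRisingBinomial_intCast (d : ℕ) :
    fwdDiff (1 : ℤ) (fun m : ℤ => smoothRisingBinomial (d + 1) m) =
      fun m : ℤ => smoothRisingBinomial d ((m + 1 : ℤ) : ℝ) := by
  funext m
  simp only [fwdDiff]
  rcases lt_trichotomy m 0 with hm | rfl | hm
  · have h₀ : (m : ℝ) ≤ 0 := by exact_mod_cast hm.le
    have h₁ : ((m + 1 : ℤ) : ℝ) ≤ 0 := by exact_mod_cast hm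
    simp only [smoothRisingBinomial_of_nonpos _ h₀, smoothRisingBinomial_of_nonpos _ h₁, sub_zero]
  · have := risingBinomial_eval_add_one_sub d 0
    rw [risingBinomial_eval_zero, zero_add, sub_zero] at this
    simp [smoothRisingBinomial_of_nonpos, smoothRisingBinomial_of_one_le, this]
  · have h₀ : 1 ≤ (m : ℝ) := by exact_mod_cast hm
    have h₁ : 1 ≤ ((m + 1 : ℤ) : ℝ) := by push_cast; linarith
    simp only [smoothRisingBinomial_of_one_le _ h₀, smoothRisingBinomial_of_one_le _ h₁]
    push_cast
    exact risingBinomial_eval_add_one_sub d m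

theorem fwdDiff_iter_smoothRisingBinomial_intCast (d : ℕ) (m : ℤ) :
    (fwdDiff (1 : ℤ))^[d + 1] (fun k : ℤ => smoothRisingBinomial d k) m =
      if m = -d then 1 else 0 := by
  induction d generalizing m with
  | zero =>
    simp only [zero_add, Function.iterate_one, fwdDiff, Nat.cast_zero, neg_zero]
    rcases lt_trichotomy m 0 with hm | rfl | hm
    · have h₀ : (m : ℝ) ≤ 0 := by exact_mod_cast hm.le
      have h₁ : ((m + 1 : ℤ) : ℝ) ≤ 0 := by exact_mod_cast hm
      simp only [smoothRisingBinomial_of_nonpos _ h₀, smoothRisingBinomial_of_nonpos _ h₁,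
        sub_zero, hm.ne, if_false]
    · simp [smoothRisingBinomial_of_nonpos, smoothRisingBinomial_of_one_le, risingBinomial]
    · have h₀ : 1 ≤ (m : ℝ) := by exact_mod_cast hm
      have h₁ : 1 ≤ ((m + 1 : ℤ) : ℝ) := by push_cast; linarith
      simp [smoothRisingBinomial_of_one_le _ h₀, smoothRisingBinomial_of_one_le _ h₁,
        risingBinomial, hm.ne', -Int.cast_add]
  | succ d ih =>
    rw [Function.iterate_succ_apply, fwdDiff_smoothRisingBinomial_intCast,
      fwdDiff_iter_comp_add (h := (1 : ℤ)) (fun k : ℤ => smoothRisingBinomial d k) 1, ih]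
    congr 1
    push_cast
    apply propext
    constructor <;> intro h <;> linarith

theorem fwdDiff_iter_comp_intCast (F : ℝ → ℝ) (n : ℕ) (m : ℤ) :
    (fwdDiff (1 : ℝ))^[n] F m = (fwdDiff (1 : ℤ))^[n] (fun k : ℤ => F k) m := by
  simp [fwdDiff_iter_eq_sum_shift]

theorem iteratedDeriv_polynomial_eval (n : ℕ) (p : Polynomial ℝ) :
    iteratedDeriv n (fun x => p.eval x) = fun x => (Polynomial.derivative^[n] p).eval x := by
  induction n with
  | zero => simp
  | succ n ih =>
    rw [iteratedDeriv_succ, ih, Function.iterate_succ_apply']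
    funext x
    exact Polynomial.deriv _

/-- A continuous function supported in `[0, 1]` that is dual to the translate `bspline d (· + d)`
among all the translates `bspline d (· + j)`. -/
noncomputable def bsplineDual (d : ℕ) : ℝ → ℝ :=
  iteratedDeriv (d + 1) (smoothRisingBinomial d)

theorem continuous_bsplineDual (d : ℕ) : Continuous (bsplineDual d) :=
  (contDiff_smoothRisingBinomial d).continuous_iteratedDeriv _ (by exact_mod_cast le_top)

theorem bsplineDual_of_neg (d : ℕ) {x : ℝ} (hx : x < 0) : bsplineDual d x = 0 := by
  have h : smoothRisingBinomial d =ᶠ[nhds x] fun _ => 0 :=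
    Filter.mem_of_superset (Iio_mem_nhds hx) fun y (hy : y < 0) =>
      smoothRisingBinomial_of_nonpos d hy.le
  rw [bsplineDual, h.iteratedDeriv_eq]
  simp

theorem bsplineDual_of_one_lt (d : ℕ) {x : ℝ} (hx : 1 < x) : bsplineDual d x = 0 := by
  have h : smoothRisingBinomial d =ᶠ[nhds x] fun y => (risingBinomial d).eval y :=
    Filter.mem_of_superset (Ioi_mem_nhds hx) fun y (hy : 1 < y) =>
      smoothRisingBinomial_of_one_le d hy.le
  have hdeg : (risingBinomial d).natDegree < d + 1 :=
    (Polynomial.natDegree_C_mul_le _ _).trans_lt (by simp [ascPochhammer_natDegree])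
  rw [bsplineDual, h.iteratedDeriv_eq, iteratedDeriv_polynomial_eval,
    Polynomial.iterate_derivative_eq_zero hdeg]
  exact Polynomial.eval_zero

theorem exists_norm_bsplineDual_le (d : ℕ) : ∃ M : ℝ, 0 < M ∧ ∀ x, ‖bsplineDual d x‖ ≤ M := by
  have hs : HasCompactSupport (bsplineDual d) :=
    HasCompactSupport.intro (isCompact_Icc (a := (0 : ℝ)) (b := 1)) fun x hx => by
      rcases lt_or_ge x 0 with h | h
      · exact bsplineDual_of_neg d h
      · exact bsplineDual_of_one_lt d (not_le.1 fun h' => hx ⟨h, h'⟩)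
  obtain ⟨M, hM⟩ := hs.exists_bound_of_continuous (continuous_bsplineDual d)
  exact ⟨max M 1, by positivity, fun x => (hM x).trans (le_max_left _ _)⟩

theorem integral_bsplineDual_mul_bspline (d j : ℕ) :
    ∫ t in Set.Ico (0 : ℝ) 1, bsplineDual d t * bspline d (t + j) = if j = d then 1 else 0 := by
  have hsupp : ∫ t in Set.Ico (0 : ℝ) 1, bsplineDual d t * bspline d (t + j) =
      ∫ t, bsplineDual d t * bspline d (t + j) := by
    rw [integral_Ico_eq_integral_Ioc, ← integral_Icc_eq_integral_Ioc]
    refine setIntegral_eq_integral_of_forall_compl_eq_zero fun t ht => ?_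
    rcases lt_or_ge t 0 with h | h
    · simp [bsplineDual_of_neg d h]
    · simp [bsplineDual_of_one_lt d (not_le.1 fun h' => ht ⟨h, h'⟩)]
  have hshift : ContDiff ℝ (⊤ : ℕ∞) fun x => smoothRisingBinomial d (x + ((-j : ℤ) : ℝ)) :=
    (contDiff_smoothRisingBinomial d).comp (contDiff_id.add contDiff_const)
  have key := integral_iteratedDeriv_mul_bspline d hshift
  rw [fwdDiff_iter_comp_add, zero_add, fwdDiff_iter_comp_intCast,
    fwdDiff_iter_smoothRisingBinomial_intCast] at key
  rw [hsupp, ← integral_add_right_eq_self _ (-(j : ℝ))]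
  simp only [neg_add_cancel_right, bsplineDual]
  rw [iteratedDeriv_comp_add_const] at key
  simpa using key

theorem norm_mul_bspline_le (d : ℕ) (a : ℂ) (s : ℝ) : ‖a * (bspline d s : ℂ)‖ ≤ ‖a‖ := by
  rw [norm_mul, Complex.norm_real]
  exact mul_le_of_le_one_right (norm_nonneg _) (norm_bspline_le_one d s)

theorem tsum_mul_bspline_eq_sum (d : ℕ) (ξ : ℤ → ℂ) (s : ℝ) :
    ∑' k : ℤ, ξ k * (bspline d (s - k) : ℂ) =
      ∑ j ∈ Finset.range (d + 1), ξ (⌊s⌋ - j) * (bspline d (Int.fract s + j) : ℂ) := by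
  have hinj : Set.InjOn (fun j : ℕ => ⌊s⌋ - (j : ℤ)) (Finset.range (d + 1)) :=
    fun i _ j _ h => by simpa using h
  rw [tsum_eq_sum (s := (Finset.range (d + 1)).image fun j : ℕ => ⌊s⌋ - (j : ℤ)),
    Finset.sum_image hinj]
  · refine Finset.sum_congr rfl fun j _ => ?_
    congr 3
    push_cast
    rw [← Int.self_sub_floor]
    ring
  · intro k hk
    rw [bspline_eq_zero_of_notMem, Complex.ofReal_zero, mul_zero]
    rintro ⟨h₀, h₁⟩
    have hle : k ≤ ⌊s⌋ := Int.le_floor.2 (by linarith)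
    have hlt : ⌊s⌋ < k + (d + 1) := Int.floor_lt.2 (by push_cast; linarith)
    refine hk (Finset.mem_image.2 ⟨(⌊s⌋ - k).toNat, ?_, ?_⟩)
    · rw [Finset.mem_range]
      omega
    · omega

/-- The restriction to a unit cell of a spline with coefficients `a`. -/
noncomputable def splinePiece (d : ℕ) (a : ℕ → ℂ) (t : ℝ) : ℂ :=
  ∑ j ∈ Finset.range (d + 1), a j * (bspline d (t + j) : ℂ)

theorem measurable_splinePiece (d : ℕ) (a : ℕ → ℂ) : Measurable (splinePiece d a) := by
  refine Finset.measurable_fun_sum _ fun j _ => ?_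
  exact measurable_const.mul
    (Complex.measurable_ofReal.comp ((measurable_bspline d).comp (measurable_id.add_const _)))

theorem norm_splinePiece_sq_le (d : ℕ) (a : ℕ → ℂ) (t : ℝ) :
    ‖splinePiece d a t‖ ^ 2 ≤ (d + 1) * ∑ j ∈ Finset.range (d + 1), ‖a j‖ ^ 2 := by
  have h : ‖splinePiece d a t‖ ≤ ∑ j ∈ Finset.range (d + 1), ‖a j‖ :=
    norm_sum_le_of_le _ fun j _ => norm_mul_bspline_le d _ _
  calc ‖splinePiece d a t‖ ^ 2 ≤ (∑ j ∈ Finset.range (d + 1), ‖a j‖) ^ 2 := by gcongr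
    _ ≤ _ := by simpa using sq_sum_le_card_mul_sum_sq (s := Finset.range (d + 1)) (f := (‖a ·‖))

theorem integrableOn_norm_splinePiece_sq (d : ℕ) (a : ℕ → ℂ) :
    IntegrableOn (fun t => ‖splinePiece d a t‖ ^ 2) (Set.Ico 0 1) := by
  refine Integrable.of_bound ((measurable_splinePiece d a).norm.pow_const 2).aestronglyMeasurable
    ((d + 1) * ∑ j ∈ Finset.range (d + 1), ‖a j‖ ^ 2) (.of_forall fun t => ?_)
  rw [Real.norm_of_nonneg (by positivity)]
  exact norm_splinePiece_sq_le d a t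

theorem integral_norm_splinePiece_sq_le (d : ℕ) (a : ℕ → ℂ) :
    ∫ t in Set.Ico (0 : ℝ) 1, ‖splinePiece d a t‖ ^ 2 ≤
      (d + 1) * ∑ j ∈ Finset.range (d + 1), ‖a j‖ ^ 2 := by
  calc ∫ t in Set.Ico (0 : ℝ) 1, ‖splinePiece d a t‖ ^ 2
      ≤ ∫ _ in Set.Ico (0 : ℝ) 1, (d + 1) * ∑ j ∈ Finset.range (d + 1), ‖a j‖ ^ 2 :=
        integral_mono (integrableOn_norm_splinePiece_sq d a) (integrable_const _)
          (norm_splinePiece_sq_le d a)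
    _ = _ := by simp

theorem integral_bsplineDual_mul_splinePiece (d : ℕ) (a : ℕ → ℂ) :
    ∫ t in Set.Ico (0 : ℝ) 1, (bsplineDual d t : ℂ) * splinePiece d a t = a d := by
  obtain ⟨M, -, hM⟩ := exists_norm_bsplineDual_le d
  have hint : ∀ j : ℕ, IntegrableOn (fun t => a j * ((bsplineDual d t * bspline d (t + j) : ℝ) : ℂ))
      (Set.Ico 0 1) := fun j => by
    refine Integrable.const_mul (Integrable.ofReal ?_) _
    refine Integrable.of_bound ((continuous_bsplineDual d).measurable.mul
      ((measurable_bspline d).comp (measurable_id.add_const _))).aestronglyMeasurable M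
      (.of_forall fun t => ?_)
    exact (norm_mul_le _ _).trans <|
      (mul_le_of_le_one_right (norm_nonneg _) (norm_bspline_le_one d _)).trans (hM t)
  calc ∫ t in Set.Ico (0 : ℝ) 1, (bsplineDual d t : ℂ) * splinePiece d a t
      = ∫ t in Set.Ico (0 : ℝ) 1, ∑ j ∈ Finset.range (d + 1),
          a j * ((bsplineDual d t * bspline d (t + j) : ℝ) : ℂ) := by
        congr 1
        funext t
        rw [splinePiece, Finset.mul_sum]
        refine Finset.sum_congr rfl fun j _ => ?_
        push_cast
        ring
    _ = ∑ j ∈ Finset.range (d + 1), a j * ((if j = d then 1 else 0 : ℝ) : ℂ) := by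
        rw [integral_finsetSum _ fun j _ => hint j]
        refine Finset.sum_congr rfl fun j _ => ?_
        rw [integral_const_mul, integral_complex_ofReal, integral_bsplineDual_mul_bspline]
    _ = a d := by
        rw [Finset.sum_eq_single_of_mem d (Finset.self_mem_range_succ d) fun j _ hj => by
          rw [if_neg hj, Complex.ofReal_zero, mul_zero]]
        rw [if_pos rfl, Complex.ofReal_one, mul_one]

theorem norm_sq_le_integral_norm_splinePiece_sq {d : ℕ} {M : ℝ} (hM : ∀ x, ‖bsplineDual d x‖ ≤ M)
    (a : ℕ → ℂ) :
    ‖a d‖ ^ 2 ≤ M ^ 2 * ∫ t in Set.Ico (0 : ℝ) 1, ‖splinePiece d a t‖ ^ 2 := by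
  set A := ∫ t in Set.Ico (0 : ℝ) 1, ‖splinePiece d a t‖ ^ 2
  have hbound : ∀ t, 2 * ‖a d‖ * ‖(bsplineDual d t : ℂ) * splinePiece d a t‖ ≤
      M ^ 2 * ‖splinePiece d a t‖ ^ 2 + ‖a d‖ ^ 2 := by
    intro t
    rw [norm_mul, Complex.norm_real]
    have h₁ : ‖bsplineDual d t‖ * ‖splinePiece d a t‖ ≤ M * ‖splinePiece d a t‖ :=
      mul_le_mul_of_nonneg_right (hM t) (norm_nonneg _)
    nlinarith [mul_le_mul_of_nonneg_left h₁ (norm_nonneg (a d)),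
      sq_nonneg (M * ‖splinePiece d a t‖ - ‖a d‖)]
  have hsq := integrableOn_norm_splinePiece_sq d a
  have h₁ : ‖a d‖ ≤ ∫ t in Set.Ico (0 : ℝ) 1, ‖(bsplineDual d t : ℂ) * splinePiece d a t‖ := by
    conv_lhs => rw [← integral_bsplineDual_mul_splinePiece d a]
    exact norm_integral_le_integral_norm _
  have h₂ : 2 * ‖a d‖ * ∫ t in Set.Ico (0 : ℝ) 1, ‖(bsplineDual d t : ℂ) * splinePiece d a t‖ ≤
      M ^ 2 * A + ‖a d‖ ^ 2 := by
    rw [← integral_const_mul]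
    refine (integral_mono_of_nonneg (.of_forall fun t => by positivity)
      ((hsq.const_mul (M ^ 2)).add (integrable_const (‖a d‖ ^ 2))) (.of_forall hbound)).trans ?_
    simp only [Pi.add_apply]
    rw [integral_add (hsq.const_mul (M ^ 2)) (integrable_const _), integral_const_mul]
    simp [A]
  nlinarith [mul_le_mul_of_nonneg_left h₁ (norm_nonneg (a d))]

theorem tsum_mul_bspline_intCast_add (d : ℕ) (ξ : ℤ → ℂ) (m : ℤ) {t : ℝ}
    (ht : t ∈ Set.Ico (0 : ℝ) 1) :
    ∑' k : ℤ, ξ k * (bspline d (t + m - k) : ℂ) = splinePiece d (fun j => ξ (m - j)) t := by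
  rw [tsum_mul_bspline_eq_sum, Int.floor_add_intCast, Int.fract_add_intCast,
    Int.floor_eq_zero_iff.2 ht, Int.fract_eq_self.2 ht, zero_add, splinePiece]

theorem hasSum_integral_norm_splinePiece_sq (d : ℕ) {ξ : ℤ → ℂ}
    (hξ : Summable fun k : ℤ => ‖ξ k‖ ^ 2) :
    HasSum (fun m : ℤ => ∫ t in Set.Ico (0 : ℝ) 1, ‖splinePiece d (fun j => ξ (m - j)) t‖ ^ 2)
      (∫ s : ℝ, ‖∑' k : ℤ, ξ k * (bspline d (s - k) : ℂ)‖ ^ 2) := by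
  set f : ℝ → ℝ := fun s => ‖∑' k : ℤ, ξ k * (bspline d (s - k) : ℂ)‖ ^ 2 with hf
  have hpre : ∀ m : ℤ, (fun t : ℝ => t + m) ⁻¹' Set.Ico (m : ℝ) (m + 1) = Set.Ico 0 1 := by
    intro m
    simp
  have hmp : ∀ m : ℤ, MeasurePreserving (fun t : ℝ => t + m) := fun m =>
    measurePreserving_add_right volume (m : ℝ)
  have hemb : ∀ m : ℤ, MeasurableEmbedding (fun t : ℝ => t + m) := fun m =>
    measurableEmbedding_addRight (m : ℝ)
  have heq : ∀ m : ℤ, Set.EqOn (fun t => f (t + m))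
      (fun t => ‖splinePiece d (fun j => ξ (m - j)) t‖ ^ 2) (Set.Ico 0 1) := fun m t ht => by
    simp only [hf, tsum_mul_bspline_intCast_add d ξ m ht]
  have hA : ∀ m : ℤ, ∫ s in Set.Ico (m : ℝ) (m + 1), f s =
      ∫ t in Set.Ico (0 : ℝ) 1, ‖splinePiece d (fun j => ξ (m - j)) t‖ ^ 2 := fun m => by
    rw [← (hmp m).setIntegral_preimage_emb (hemb m), hpre]
    exact setIntegral_congr_fun measurableSet_Ico (heq m)
  have hI : ∀ m : ℤ, IntegrableOn f (Set.Ico (m : ℝ) (m + 1)) := fun m => by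
    rw [← (hmp m).integrableOn_comp_preimage (hemb m), hpre]
    exact (integrableOn_norm_splinePiece_sq d _).congr_fun (heq m).symm measurableSet_Ico
  have hsum : Summable fun m : ℤ => ∫ s in Set.Ico (m : ℝ) (m + 1), ‖f s‖ := by
    have hn : ∀ s, ‖f s‖ = f s := fun s => Real.norm_of_nonneg (by positivity)
    simp only [hn, hA]
    refine Summable.of_nonneg_of_le (fun m => integral_nonneg fun t => by positivity)
      (fun m => integral_norm_splinePiece_sq_le d _) (Summable.mul_left _ ?_)
    exact summable_sum fun j _ => (Equiv.subRight (j : ℤ)).summable_iff.2 hξ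
  have hint := integrableOn_iUnion_of_summable_integral_norm
    hI hsum
  have := hasSum_integral_iUnion (fun m : ℤ => measurableSet_Ico (a := (m : ℝ)) (b := m + 1))
    (Set.pairwise_disjoint_Ico_intCast ℝ) hint
  rw [iUnion_Ico_intCast, setIntegral_univ] at this
  simpa only [hA] using this

theorem integral_norm_tsum_mul_bspline_sq_le (d : ℕ) {ξ : ℤ → ℂ}
    (hξ : Summable fun k : ℤ => ‖ξ k‖ ^ 2) :
    ∫ s : ℝ, ‖∑' k : ℤ, ξ k * (bspline d (s - k) : ℂ)‖ ^ 2 ≤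
      (d + 1) ^ 2 * ∑' k : ℤ, ‖ξ k‖ ^ 2 := by
  have hshift : ∀ j : ℕ, HasSum (fun m : ℤ => ‖ξ (m - j)‖ ^ 2) (∑' k : ℤ, ‖ξ k‖ ^ 2) :=
    fun j => (Equiv.subRight (j : ℤ)).hasSum_iff.2 hξ.hasSum
  have h := (hasSum_sum (s := Finset.range (d + 1)) fun j _ => hshift j).mul_left ((d : ℝ) + 1)
  refine (hasSum_le (fun m => integral_norm_splinePiece_sq_le d _)
    (hasSum_integral_norm_splinePiece_sq d hξ) h).trans_eq ?_
  simp
  ring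

theorem tsum_norm_sq_le {d : ℕ} {M : ℝ} (hM : ∀ x, ‖bsplineDual d x‖ ≤ M) {ξ : ℤ → ℂ}
    (hξ : Summable fun k : ℤ => ‖ξ k‖ ^ 2) :
    ∑' k : ℤ, ‖ξ k‖ ^ 2 ≤
      M ^ 2 * ∫ s : ℝ, ‖∑' k : ℤ, ξ k * (bspline d (s - k) : ℂ)‖ ^ 2 := by
  have hshift : HasSum (fun m : ℤ => ‖ξ (m - d)‖ ^ 2) (∑' k : ℤ, ‖ξ k‖ ^ 2) :=
    (Equiv.subRight (d : ℤ)).hasSum_iff.2 hξ.hasSum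
  exact hasSum_le (fun m => norm_sq_le_integral_norm_splinePiece_sq hM fun j => ξ (m - j)) hshift
    ((hasSum_integral_norm_splinePiece_sq d hξ).mul_left _)

theorem sqrt_mul_sqrt_integral_comp_mul_left {n : ℕ} (hn : 1 ≤ n) (f : ℝ → ℝ) :
    Real.sqrt n * Real.sqrt (∫ s, f (n * s)) = Real.sqrt (∫ s, f s) := by
  have hn' : (0 : ℝ) < n := by exact_mod_cast hn
  rw [Measure.integral_comp_mul_left, ← Real.sqrt_mul hn'.le, abs_of_pos (inv_pos.2 hn'),
    smul_eq_mul, mul_inv_cancel_left₀ hn'.ne']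

/-- de Boor's spline stability estimate. -/
theorem deBoor_spline_stability (d : ℕ) :
    ∃ c₁ c₂ : ℝ, 0 < c₁ ∧ 0 < c₂ ∧
      ∀ n : ℕ, 1 ≤ n → ∀ ξ : ℤ → ℂ, (Summable fun k : ℤ => ‖ξ k‖ ^ 2) →
        Real.sqrt (∑' k : ℤ, ‖ξ k‖ ^ 2) ≤
            c₁ * Real.sqrt n *
              Real.sqrt (∫ s : ℝ, ‖∑' k : ℤ, ξ k * (bspline d (n * s - k) : ℂ)‖ ^ 2) ∧
          c₁ * Real.sqrt n *
              Real.sqrt (∫ s : ℝ, ‖∑' k : ℤ, ξ k * (bspline d (n * s - k) : ℂ)‖ ^ 2) ≤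
            c₂ * Real.sqrt (∑' k : ℤ, ‖ξ k‖ ^ 2) := by
  obtain ⟨M, hM₀, hM⟩ := exists_norm_bsplineDual_le d
  refine ⟨M, M * (d + 1), hM₀, by positivity, fun n hn ξ hξ => ?_⟩
  rw [mul_assoc, sqrt_mul_sqrt_integral_comp_mul_left hn
    fun s => ‖∑' k : ℤ, ξ k * (bspline d (s - k) : ℂ)‖ ^ 2]
  constructor
  · refine (Real.sqrt_le_sqrt (tsum_norm_sq_le hM hξ)).trans_eq ?_
    rw [Real.sqrt_mul (sq_nonneg M), Real.sqrt_sq hM₀.le]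
  · rw [mul_assoc]
    refine mul_le_mul_of_nonneg_left ?_ hM₀.le
    refine (Real.sqrt_le_sqrt (integral_norm_tsum_mul_bspline_sq_le d hξ)).trans_eq ?_
    rw [Real.sqrt_mul (by positivity), Real.sqrt_sq (by positivity)]
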